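/- arXiv:1910.09653 — 2 statements merged into one kernel-verified Lean document; each statement's English description precedes it below -/
import Mathlib

section
/- Let q be a prime power, n a positive integer, and let d be an integer with 1 ≤ d and d < n/2 − 1. Let f(y) = a₀y + a₁y^q + ⋯ + a_d y^{q^d} be an F_q-linearised polynomial over F_{q^n} of q-degree d (so a₀, …, a_d ∈ F_{q^n} and a_d ≠ 0). Then there exist nonzero x, y ∈ F_{q^n} such that x·y = Tr(x)·f(y); equivalently, the linear sets {(x : Tr(x)) : x ∈ F_{q^n}*} and {(f(y) : y) : y ∈ F_{q^n}*} in PG(1, q^n) have at least one point in common. -/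
section

open Finset

/-- Indicator of the cyclic interval `{j, j + 1, …, j + i - 1}` modulo `n`, for `j < n`. -/
def arc (n i j x : ℕ) : ℕ := if (j ≤ x ∧ x < j + i) ∨ x + n < j + i then 1 else 0

lemma sum_arc_mul {n j : ℕ} (hj : j < n) (g : ℕ → ℕ) {i : ℕ} (hi : i ≤ n) :
    ∑ x ∈ range n, arc n i j x * g x = ∑ l ∈ range i, g ((j + l) % n) := by
  induction i with
  | zero =>
    refine sum_eq_zero fun x _ => ?_
    have : arc n 0 j x = 0 := if_neg (by omega)
    simp [this]
  | succ i ih =>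
    rw [sum_range_succ, ← ih (by omega)]
    have hlt : (j + i) % n < n := Nat.mod_lt _ (by omega)
    have hmod : (j + i) % n = if j + i < n then j + i else j + i - n := by
      split_ifs with h
      · exact Nat.mod_eq_of_lt h
      · rw [Nat.mod_eq_sub_mod (by omega), Nat.mod_eq_of_lt (by omega)]
    have step : ∀ x ∈ range n, arc n (i + 1) j x * g x =
        arc n i j x * g x + if x = (j + i) % n then g x else 0 := by
      intro x hx
      have hx := mem_range.1 hx
      have : arc n (i + 1) j x = arc n i j x + if x = (j + i) % n then 1 else 0 := by
        rw [hmod]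
        unfold arc
        split_ifs <;> omega
      rw [this]
      split_ifs <;> ring
    rw [sum_congr rfl step, sum_add_distrib, sum_ite_eq' (range n), if_pos (mem_range.2 hlt)]

lemma modEq_sum_arc {n i j q : ℕ} (hq : 1 ≤ q) (hj : j < n) (hi : i ≤ n) :
    (q ^ i - 1) * q ^ j ≡ (q - 1) * ∑ x ∈ range n, arc n i j x * q ^ x [MOD q ^ n - 1] := by
  have hone : q ^ n ≡ 1 [MOD q ^ n - 1] := by
    have h : 1 ≤ q ^ n := Nat.one_le_pow _ _ hq
    exact ((Nat.modEq_iff_dvd' h).2 dvd_rfl).symm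
  have hred : ∀ l, q ^ (l % n) ≡ q ^ l [MOD q ^ n - 1] := by
    intro l
    conv_rhs => rw [← Nat.mod_add_div l n, pow_add, pow_mul]
    simpa using ((hone.pow (l / n)).mul_left (q ^ (l % n))).symm
  rw [sum_arc_mul hj _ hi]
  have h2 : (q ^ i - 1) * q ^ j = (q - 1) * ∑ l ∈ range i, q ^ (j + l) := by
    simp_rw [pow_add]
    rw [← mul_sum, ← geom_sum_mul_of_one_le hq i]
    ring
  rw [h2]
  refine Nat.ModEq.mul_left _ ?_
  exact Nat.ModEq.sum fun l _ => (hred (j + l)).symm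

lemma exists_carry {p : ℤ} (hp : 0 < p) {N : ℕ} (δ : ℕ → ℤ)
    (h : ∑ i ∈ range N, δ i * p ^ i = 0) :
    ∃ c : ℕ → ℤ, c 0 = 0 ∧ c N = 0 ∧ ∀ i < N, p * c (i + 1) = c i + δ i := by
  have hdvd : ∀ i ≤ N, p ^ i ∣ ∑ j ∈ range i, δ j * p ^ j := by
    intro i hi
    rw [← sum_range_add_sum_Ico _ hi] at h
    rw [eq_neg_of_add_eq_zero_left h, dvd_neg]
    exact dvd_sum fun j hj => (pow_dvd_pow p (mem_Ico.1 hj).1).mul_left _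
  refine ⟨fun i => (∑ j ∈ range i, δ j * p ^ j) / p ^ i, by simp, by simp [h], fun i hi => ?_⟩
  have h1 := Int.ediv_mul_cancel (hdvd i hi.le)
  have h2 := Int.ediv_mul_cancel (hdvd (i + 1) hi)
  rw [sum_range_succ] at h2
  have hpi : p ^ i ≠ 0 := (pow_pos hp i).ne'
  refine mul_right_cancel₀ hpi ?_
  beta_reduce
  rw [add_mul, h1, ← h2, sum_range_succ]
  ring

lemma carry_le_one {p N : ℕ} {a s : ℕ → ℕ} (hp : 0 < p) (ha : ∀ i < N, a i + 2 ≤ 2 * p)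
    (hs : ∀ i < N, s i < p) (h : ∑ i ∈ range N, s i * p ^ i = ∑ i ∈ range N, a i * p ^ i) :
    ∃ c : ℕ → ℕ, c 0 = 0 ∧ c N = 0 ∧ ∀ i < N, c i ≤ 1 ∧ c (i + 1) ≤ 1 ∧
      s i + p * c (i + 1) = a i + c i := by
  obtain ⟨c, h0, hN, hc⟩ := exists_carry (p := p) (by exact_mod_cast hp) (N := N)
    (fun i => (a i : ℤ) - s i) (by
      simp only [sub_mul, sum_sub_distrib]
      rw [sub_eq_zero]
      exact_mod_cast h.symm)
  have hb : ∀ i ≤ N, 0 ≤ c i ∧ c i ≤ 1 := by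
    intro i
    induction i with
    | zero => simp [h0]
    | succ i ih =>
      intro hi
      have hi' : i < N := hi
      obtain ⟨l, u⟩ := ih hi'.le
      have e := hc i hi'
      have ha := ha i hi'
      have hs := hs i hi'
      constructor
      · by_contra hlt
        nlinarith
      · by_contra hlt
        nlinarith
  refine ⟨fun i => (c i).toNat, by simp [h0], by simp [hN], fun i hi => ?_⟩
  have b1 := hb i hi.le
  have b2 := hb (i + 1) hi
  dsimp only
  refine ⟨by omega, by omega, ?_⟩
  have e := hc i hi
  zify
  rw [Int.toNat_of_nonneg b1.1, Int.toNat_of_nonneg b2.1]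
  linarith

lemma sum_range_mul_eq {M : Type*} [AddCommMonoid M] (n e : ℕ) (f : ℕ → M) :
    ∑ i ∈ range (n * e), f i = ∑ x ∈ range n, ∑ t ∈ range e, f (x * e + t) := by
  induction n with
  | zero => simp
  | succ n ih => rw [add_mul, one_mul, sum_range_add, sum_range_succ, ih]

lemma carry_eq_zero {n d e p m : ℕ} (hd : 1 ≤ d) (hn : 2 * d + 2 < n) (hp : 2 ≤ p)
    (hm : m = (p - 1) / 2) (hpar : p = 2 ∨ p = 2 * m + 1) {g c : ℕ → ℕ} {s ε : ℕ → ℕ → ℕ}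
    (hg0 : g 0 = m) (hgd : g d = p - 1 - m) (hg : ∀ x, d < x → x < n → g x = 0)
    (hpair : ∀ t < e, ∀ x y, x + d ≤ y → y < n → y + d ≤ x + n → s x t + s y t ≤ p - 1)
    (hc : ∀ t < e, c t < p) (hne : ∃ t < e, c t ≠ p - 1)
    (hε : ∀ x < n, ∀ t ≤ e, ε x t ≤ 1) (h00 : ε 0 0 = 0)
    (hwrap : ∀ x, x + 1 < n → ε x e = ε (x + 1) 0)
    (heq : ∀ x < n, ∀ t < e, s x t + p * ε x (t + 1) = g x + c t + ε x t) :
    ∀ t < e, c t = 0 := by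
  have hstep : ∀ x, d < x → x < n → ∀ t < e, ε x (t + 1) = 1 → c t = p - 1 ∧ ε x t = 1 := by
    intro x h1 h2 t ht h
    have := heq x h2 t ht
    have := hε x h2 t ht.le
    have := hc t ht
    rw [h, hg x h1 h2] at *
    omega
  have hdown : ∀ x, d < x → x < n → ∀ t ≤ e, ε x t = 1 → ε x 0 = 1 ∧ ∀ r < t, c r = p - 1 := by
    intro x h1 h2 t
    induction t with
    | zero => exact fun _ h => ⟨h, by simp⟩
    | succ t ih =>
      intro ht h
      obtain ⟨h3, h4⟩ := hstep x h1 h2 t ht h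
      obtain ⟨h5, h6⟩ := ih (by omega) h4
      refine ⟨h5, fun r hr => ?_⟩
      rcases Nat.lt_succ_iff_lt_or_eq.1 hr with hr | rfl
      · exact h6 r hr
      · exact h3
  have htop : ∀ x, d < x → x < n → ε x e = 0 := by
    intro x h1 h2
    by_contra h
    have := hε x h2 e le_rfl
    obtain ⟨t, ht, hct⟩ := hne
    exact hct ((hdown x h1 h2 e le_rfl (by omega)).2 t ht)
  have hfar : ∀ x, d + 1 < x → x < n → ∀ t ≤ e, ε x t = 0 := by
    intro x h1 h2 t ht
    by_contra h
    have h3 := hε x h2 t ht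
    have h4 := (hdown x (by omega) h2 t ht (by omega)).1
    obtain ⟨x, rfl⟩ : ∃ y, x = y + 1 := ⟨x - 1, by omega⟩
    rw [← hwrap x h2, htop x (by omega) (by omega)] at h4
    omega
  have hhalf : ∀ t < e, 2 * c t ≤ p - 1 := by
    intro t ht
    have h1 := heq (d + 2) (by omega) t ht
    have h2 := heq (2 * d + 2) (by omega) t ht
    have h3 := hpair t ht (d + 2) (2 * d + 2) (by omega) (by omega) (by omega)
    rw [hfar _ (by omega) (by omega) _ ht, hfar _ (by omega) (by omega) _ ht.le,
      hg _ (by omega) (by omega)] at h1 h2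
    omega
  rcases hpar with rfl | hpar
  · intro t ht
    have := hhalf t ht
    omega
  have hm1 : 1 ≤ m := by omega
  have hε0 : ∀ t ≤ e, ε 0 t = 0 := by
    intro t
    induction t with
    | zero => exact fun _ => h00
    | succ t ih =>
      intro ht
      have h1 := heq 0 (by omega) t ht
      have h2 := hhalf t ht
      have h3 := hε 0 (by omega) (t + 1) ht
      rw [ih (by omega), hg0] at h1
      interval_cases ε 0 (t + 1) <;> omega
  have hdich : ∀ t < e, (c t = 0 ∧ ε d t = 0 ∧ ε d (t + 1) = 0) ∨
      (c t = m ∧ ε d t = 1 ∧ ε d (t + 1) = 1) := by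
    intro t ht
    have h1 := heq 0 (by omega) t ht
    have h2 := heq d (by omega) t ht
    have h3 := hpair t ht 0 d (by omega) (by omega) (by omega)
    have h4 := hε d (by omega) t ht.le
    have h5 := hε d (by omega) (t + 1) ht
    have h6 := hhalf t ht
    rw [hε0 t ht.le, hε0 (t + 1) ht, hg0] at h1
    rw [hgd] at h2
    interval_cases ε d (t + 1) <;> omega
  have hconst : ∀ t ≤ e, ε d t = ε d 0 := by
    intro t
    induction t with
    | zero => exact fun _ => rfl
    | succ t ih =>
      intro ht
      have := ih (by omega)
      rcases hdich t ht with h | h <;> omega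
  intro t ht
  by_contra hct
  have h1 : ε d 0 = 1 := by
    rcases hdich t ht with h | h
    · exact absurd h.1 hct
    · rw [← hconst t ht.le, h.2.1]
  have he : 0 < e := by omega
  have h2 : ε (d + 1) 0 = 1 := by rw [← hwrap d (by omega), hconst e le_rfl, h1]
  have h3 : c 0 = m := by
    rcases hdich 0 he with h | h <;> omega
  have h4 := heq (d + 1) (by omega) 0 he
  have h5 := heq (2 * d + 1) (by omega) 0 he
  have h6 := hpair 0 he (d + 1) (2 * d + 1) (by omega) (by omega) (by omega)
  have h7 : ε (d + 1) (0 + 1) = 0 := by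
    by_contra h
    have := hε (d + 1) (by omega) 1 he
    have := (hstep (d + 1) (by omega) (by omega) 0 he (by simp at *; omega)).1
    omega
  have h8 : ε (2 * d + 1) (0 + 1) = 0 := by
    by_contra h
    have := hε (2 * d + 1) (by omega) 1 he
    have := (hstep (2 * d + 1) (by omega) (by omega) 0 he (by simp at *; omega)).1
    omega
  rw [h7, hg _ (by omega) (by omega)] at h4
  rw [h8, hg _ (by omega) (by omega)] at h5
  omega

lemma sum_digits_mul_pow (p c e : ℕ) : ∑ t ∈ range e, c / p ^ t % p * p ^ t = c % p ^ e := by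
  induction e with
  | zero => simp [Nat.mod_one]
  | succ e ih => rw [sum_range_succ, ih, Nat.mod_pow_succ, mul_comm]

lemma digits_eq_of_modEq {n d e p m : ℕ} (hd : 1 ≤ d) (hn : 2 * d + 2 < n) (hp : 2 ≤ p)
    (he : 1 ≤ e) (hm : m = (p - 1) / 2) (hpar : p = 2 ∨ p = 2 * m + 1) {g : ℕ → ℕ}
    {s : ℕ → ℕ → ℕ}
    (hg0 : g 0 = m) (hgd : g d = p - 1 - m) (hg : ∀ x, d < x → x < n → g x = 0)
    (hgp : ∀ x < n, g x ≤ p - 1) (hs : ∀ x < n, ∀ t < e, s x t ≤ p - 1)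
    (hpair : ∀ t < e, ∀ x y, x + d ≤ y → y < n → y + d ≤ x + n → s x t + s y t ≤ p - 1)
    (h : ∑ x ∈ range n, (∑ t ∈ range e, s x t * p ^ t) * (p ^ e) ^ x ≡
      ∑ x ∈ range n, (∑ t ∈ range e, g x * p ^ t) * (p ^ e) ^ x
        [MOD ∑ x ∈ range n, (p ^ e) ^ x]) :
    ∀ x < n, ∀ t < e, s x t = g x := by
  have hq : 1 ≤ p ^ e := Nat.one_le_pow _ _ (by omega)
  have hdigit : ∀ f : ℕ → ℕ, (∀ t < e, f t ≤ p - 1) →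
      ∑ t ∈ range e, f t * p ^ t ≤ p ^ e - 1 := by
    intro f hf
    rw [← geom_sum_mul_of_one_le (by omega : 1 ≤ p) e, sum_mul]
    refine sum_le_sum fun t ht => ?_
    rw [mul_comm]
    exact Nat.mul_le_mul_left _ (hf t (mem_range.1 ht))
  set N := ∑ x ∈ range n, (p ^ e) ^ x with hN
  set W := ∑ x ∈ range n, (∑ t ∈ range e, g x * p ^ t) * (p ^ e) ^ x with hW
  set V := ∑ x ∈ range n, (∑ t ∈ range e, s x t * p ^ t) * (p ^ e) ^ x with hV
  have hWN : W < N := by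
    have h1 : W = ∑ x ∈ range (d + 1), (∑ t ∈ range e, g x * p ^ t) * (p ^ e) ^ x := by
      refine (sum_subset (range_subset_range.2 (by omega)) fun x hx hx' => ?_).symm
      rw [mem_range] at hx hx'
      simp [hg x (by omega) hx]
    have h2 : W ≤ (p ^ e) ^ (d + 1) - 1 := by
      rw [h1, ← geom_sum_mul_of_one_le hq, sum_mul]
      refine sum_le_sum fun x hx => ?_
      rw [mul_comm]
      have := mem_range.1 hx
      exact Nat.mul_le_mul_left _ (hdigit _ fun t _ => hgp x (by omega))
    have h3 : (p ^ e) ^ (d + 1) ≤ N :=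
      single_le_sum (f := fun x => (p ^ e) ^ x) (fun _ _ => Nat.zero_le _)
        (mem_range.2 (by omega))
    have h4 : 1 ≤ (p ^ e) ^ (d + 1) := Nat.one_le_pow _ _ hq
    omega
  have hWpos : 0 < W := by
    refine sum_pos' (fun _ _ => Nat.zero_le _) ⟨d, mem_range.2 (by omega), ?_⟩
    refine Nat.mul_pos (sum_pos' (fun _ _ => Nat.zero_le _) ⟨0, mem_range.2 he, ?_⟩)
      (by positivity)
    simp [hgd]
    omega
  have hVle : V ≤ (p ^ e - 1) * N := by
    rw [hV, hN, mul_sum]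
    exact sum_le_sum fun x hx =>
      Nat.mul_le_mul_right _ (hdigit _ fun t ht => hs x (mem_range.1 hx) t ht)
  obtain ⟨c, hc⟩ : ∃ c, V = W + c * N := by
    refine ⟨V / N, ?_⟩
    have h1 := Nat.mod_add_div V N
    rw [h, Nat.mod_eq_of_lt hWN, mul_comm] at h1
    exact h1.symm
  have hcq : c < p ^ e - 1 := by
    by_contra hlt
    have := Nat.mul_le_mul_right N (not_lt.1 hlt)
    omega
  have hcsum : ∑ t ∈ range e, c / p ^ t % p * p ^ t = c := by
    rw [sum_digits_mul_pow, Nat.mod_eq_of_lt (by omega)]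
  have hclt : ∀ t, c / p ^ t % p < p := fun t => Nat.mod_lt _ (by omega)
  have hdm : ∀ x t, t < e → (x * e + t) / e = x ∧ (x * e + t) % e = t := by
    intro x t ht
    rw [mul_comm x e]
    exact ⟨by rw [Nat.mul_add_div (by omega), Nat.div_eq_of_lt ht, add_zero],
      by rw [Nat.mul_add_mod, Nat.mod_eq_of_lt ht]⟩
  have hrange : ∀ i < n * e, i / e < n ∧ i % e < e := fun i hi =>
    ⟨(Nat.div_lt_iff_lt_mul (by omega)).2 hi, Nat.mod_lt _ (by omega)⟩
  have hflat : ∀ f : ℕ → ℕ → ℕ, ∑ i ∈ range (n * e), f (i / e) (i % e) * p ^ i =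
      ∑ x ∈ range n, (∑ t ∈ range e, f x t * p ^ t) * (p ^ e) ^ x := by
    intro f
    rw [sum_range_mul_eq]
    refine sum_congr rfl fun x _ => ?_
    rw [sum_mul]
    refine sum_congr rfl fun t ht => ?_
    obtain ⟨h1, h2⟩ := hdm x t (mem_range.1 ht)
    rw [h1, h2, pow_add, mul_comm x e, pow_mul]
    ring
  obtain ⟨C, hC0, hCN, hC⟩ := carry_le_one (p := p) (N := n * e)
    (a := fun i => g (i / e) + c / p ^ (i % e) % p) (s := fun i => s (i / e) (i % e))
    (by omega)
    (fun i hi => by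
      have h1 := hgp _ (hrange i hi).1
      have h2 := hclt (i % e)
      omega)
    (fun i hi => by
      have := hs _ (hrange i hi).1 _ (hrange i hi).2
      omega)
    (by
      rw [hflat s, hflat fun x t => g x + c / p ^ t % p, ← hV, hc, hW, hN, mul_sum,
        ← sum_add_distrib]
      refine sum_congr rfl fun x _ => ?_
      conv_lhs => rw [← hcsum]
      simp_rw [add_mul, sum_add_distrib]
      ring)
  have hidx : ∀ x < n, ∀ t < e, x * e + t < n * e := by
    intro x hx t ht
    have := Nat.mul_le_mul_right e hx
    rw [Nat.succ_mul] at this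
    omega
  have heq : ∀ x < n, ∀ t < e, s x t + p * C (x * e + (t + 1)) =
      g x + c / p ^ t % p + C (x * e + t) := by
    intro x hx t ht
    have := (hC _ (hidx x hx t ht)).2.2
    rwa [(hdm x t ht).1, (hdm x t ht).2] at this
  have hzero := carry_eq_zero (s := s) (ε := fun x t => C (x * e + t))
    (c := fun t => c / p ^ t % p) hd hn hp hm hpar hg0 hgd hg hpair (fun t _ => hclt t)
    (by
      by_contra! hall
      have : c = p ^ e - 1 := by
        rw [← geom_sum_mul_of_one_le (by omega : 1 ≤ p) e, ← hcsum, sum_mul]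
        exact sum_congr rfl fun t ht => by rw [hall t (mem_range.1 ht), mul_comm]
      omega)
    (fun x hx t ht => by
      rcases t with _ | t
      · exact (hC _ (hidx x hx 0 he)).1
      · exact (hC _ (hidx x hx t ht)).2.1)
    (by simpa using hC0)
    (fun x _ => by
      congr 1
      ring)
    heq
  have hc0 : c = 0 := by
    rw [← hcsum]
    exact sum_eq_zero fun t ht => by
      have := hzero t (mem_range.1 ht)
      rw [this, zero_mul]
  have hCzero : ∀ i ≤ n * e, C i = 0 := by
    intro i
    induction i with
    | zero => exact fun _ => hC0
    | succ i ih =>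
      intro hi
      have h1 := hC i hi
      have h2 := hgp _ (hrange i hi).1
      simp only [ih (by omega), hc0, Nat.zero_div, Nat.zero_mod] at h1
      obtain ⟨-, h3, h4⟩ := h1
      interval_cases C (i + 1)
      · rfl
      · omega
  intro x hx t ht
  have h1 := heq x hx t ht
  rw [hCzero _ (hidx x hx t ht).le, ← add_assoc (x * e), hCzero _ (hidx x hx t ht), hc0] at h1
  simpa using h1

/-- The number of cyclic intervals covering `x`, where the interval of length `b.1` starting at
`b.2` is taken with multiplicity `k b`. -/
def load (n : ℕ) (s : Finset (ℕ × ℕ)) (k : ℕ × ℕ → ℕ) (x : ℕ) : ℕ :=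
  ∑ b ∈ s, k b * arc n b.1 b.2 x

/-- Multiplicity `m` on the interval of length `d` starting at `0` and `m'` on the one
starting at `1`. -/
def twoArcs (d m m' : ℕ) : ℕ × ℕ → ℕ := Pi.single (d, 0) m + Pi.single (d, 1) m'

lemma sum_twoArcs_mul {n d : ℕ} (hn : 1 < n) (m m' : ℕ) (F : ℕ × ℕ → ℕ) :
    ∑ b ∈ range (d + 1) ×ˢ range n, twoArcs d m m' b * F b = m * F (d, 0) + m' * F (d, 1) := by
  have hsingle : ∀ (j r : ℕ), j < n → ∑ b ∈ range (d + 1) ×ˢ range n,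
      (Pi.single (d, j) r : ℕ × ℕ → ℕ) b * F b = r * F (d, j) := by
    intro j r hj
    rw [sum_eq_single (d, j)]
    · simp
    · intro b _ hb
      simp [Pi.single_eq_of_ne hb]
    · intro h
      simp [hj] at h
  simp only [twoArcs, Pi.add_apply, add_mul, sum_add_distrib]
  rw [hsingle 0 m (by omega), hsingle 1 m' hn]

lemma twoArcs_mem {n d : ℕ} (hn : 1 < n) (m m' : ℕ) :
    twoArcs d m m' ∈ (range (d + 1) ×ˢ range n).piAntidiag (m + m') := by
  rw [mem_piAntidiag]
  refine ⟨by simpa using sum_twoArcs_mul (d := d) hn m m' fun _ => 1, fun b hb => ?_⟩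
  have : b = (d, 0) ∨ b = (d, 1) := by
    by_contra! h
    exact hb (by simp [twoArcs, Pi.single_eq_of_ne h.1, Pi.single_eq_of_ne h.2])
  rcases this with rfl | rfl <;> simp <;> omega

lemma load_twoArcs {n d : ℕ} (hn : 1 < n) (m m' x : ℕ) :
    load n (range (d + 1) ×ˢ range n) (twoArcs d m m') x =
      m * arc n d 0 x + m' * arc n d 1 x :=
  sum_twoArcs_mul hn m m' fun b => arc n b.1 b.2 x

lemma load_add_load_le {n d r x y : ℕ} {k : ℕ × ℕ → ℕ}
    (hk : k ∈ (range (d + 1) ×ˢ range n).piAntidiag r) (hxy : x + d ≤ y)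
    (hyx : y + d ≤ x + n) :
    load n (range (d + 1) ×ˢ range n) k x + load n (range (d + 1) ×ˢ range n) k y ≤ r := by
  rw [← (mem_piAntidiag.1 hk).1, load, load, ← sum_add_distrib]
  refine sum_le_sum fun b hb => ?_
  rw [mem_product, mem_range, mem_range] at hb
  have : arc n b.1 b.2 x + arc n b.1 b.2 y ≤ 1 := by
    unfold arc
    split_ifs <;> omega
  nlinarith

lemma load_le {n r x : ℕ} {s : Finset (ℕ × ℕ)} {k : ℕ × ℕ → ℕ} (hk : k ∈ s.piAntidiag r) :
    load n s k x ≤ r := by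
  rw [← (mem_piAntidiag.1 hk).1, load]
  refine sum_le_sum fun b _ => ?_
  have : arc n b.1 b.2 x ≤ 1 := by
    unfold arc
    split_ifs <;> omega
  nlinarith

lemma sum_load {n d : ℕ} (hdn : d ≤ n) (k : ℕ × ℕ → ℕ) :
    ∑ x ∈ range n, load n (range (d + 1) ×ˢ range n) k x =
      ∑ b ∈ range (d + 1) ×ˢ range n, k b * b.1 := by
  simp only [load]
  rw [sum_comm]
  refine sum_congr rfl fun b hb => ?_
  rw [mem_product, mem_range, mem_range] at hb
  have := sum_arc_mul hb.2 (fun _ => 1) (i := b.1) (by omega)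
  simp only [mul_one, sum_const, card_range, smul_eq_mul] at this
  rw [← mul_sum, this]

lemma eq_twoArcs_of_load_eq {n d m m' : ℕ} (hd : 1 ≤ d) (hn : 2 * d + 2 < n) {k : ℕ × ℕ → ℕ}
    (hk : k ∈ (range (d + 1) ×ˢ range n).piAntidiag (m + m'))
    (h : ∀ x < n, load n (range (d + 1) ×ˢ range n) k x = m * arc n d 0 x + m' * arc n d 1 x) :
    k = twoArcs d m m' := by
  obtain ⟨hsum, hsupp⟩ := mem_piAntidiag.1 hk
  have hlen : ∀ b, k b ≠ 0 → b.1 = d := by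
    have h1 : ∑ b ∈ range (d + 1) ×ˢ range n, k b * b.1 =
        ∑ b ∈ range (d + 1) ×ˢ range n, k b * d := by
      rw [← sum_load (by omega), ← sum_mul, hsum,
        sum_congr rfl fun x hx => (h x (mem_range.1 hx)).trans
          (load_twoArcs (by omega) m m' x).symm,
        sum_load (by omega), sum_twoArcs_mul (by omega) m m' fun b => b.1]
      ring
    have h2 := (sum_eq_sum_iff_of_le fun b hb => Nat.mul_le_mul_left (k b)
      (Nat.lt_succ_iff.1 (mem_range.1 (mem_product.1 hb).1))).1 h1
    intro b hb
    exact Nat.eq_of_mul_eq_mul_left (Nat.pos_of_ne_zero hb) (h2 b (hsupp b hb))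
  have hzero : ∀ b x, x < n → d < x → arc n b.1 b.2 x = 1 → k b = 0 := by
    intro b x hxn hdx hb
    by_contra hkb
    have h1 := h x hxn
    have h2 : arc n d 0 x = 0 := if_neg (by omega)
    have h3 : arc n d 1 x = 0 := if_neg (by omega)
    have h4 := single_le_sum (f := fun b : ℕ × ℕ => k b * arc n b.1 b.2 x)
      (fun _ _ => Nat.zero_le _) (hsupp b hkb)
    rw [← load, h1, h2, h3] at h4
    simp only [hb] at h4
    omega
  have hpos : ∀ b, k b ≠ 0 → b = (d, 0) ∨ b = (d, 1) := by
    intro b hb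
    have h1 := hlen b hb
    have h2 := mem_range.1 (mem_product.1 (hsupp b hb)).2
    obtain ⟨i, j⟩ := b
    obtain rfl : i = d := h1
    dsimp only at h2
    by_contra! hne
    have hj : 2 ≤ j := by
      by_contra hlt
      interval_cases j <;> simp at hne
    rcases Nat.lt_or_ge i j with hij | hij
    · exact hb (hzero _ j h2 hij (if_pos (by simp only; omega)))
    · exact hb (hzero _ (j + i - 1) (by omega) (by omega) (if_pos (by simp only; omega)))
  have hrepr : k = twoArcs d (k (d, 0)) (k (d, 1)) := by
    funext b
    by_cases hb : k b = 0
    · by_cases h0 : b = (d, 0)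
      · subst h0; simp [twoArcs]
      · by_cases h1 : b = (d, 1)
        · subst h1; simp [twoArcs]
        · simp [twoArcs, h0, h1, hb]
    · rcases hpos b hb with rfl | rfl <;> simp [twoArcs]
  have a00 : arc n d 0 0 = 1 := if_pos (by omega)
  have a10 : arc n d 1 0 = 0 := if_neg (by omega)
  have a0d : arc n d 0 d = 0 := if_neg (by omega)
  have a1d : arc n d 1 d = 1 := if_pos (by omega)
  have h0 := h 0 (by omega)
  have h1 := h d (by omega)
  rw [hrepr, load_twoArcs (by omega)] at h0 h1
  rw [a00, a10] at h0
  rw [a0d, a1d] at h1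
  rw [hrepr]
  congr 1 <;> omega

lemma exponent_modEq {n d q : ℕ} (hq : 1 ≤ q) (hdn : d ≤ n) (k : ℕ × ℕ → ℕ) :
    ∑ b ∈ range (d + 1) ×ˢ range n, (q ^ b.1 - 1) * q ^ b.2 * k b ≡
      (q - 1) * ∑ x ∈ range n, load n (range (d + 1) ×ˢ range n) k x * q ^ x
        [MOD q ^ n - 1] := by
  have h : (q - 1) * ∑ x ∈ range n, load n (range (d + 1) ×ˢ range n) k x * q ^ x =
      ∑ b ∈ range (d + 1) ×ˢ range n,
        ((q - 1) * ∑ x ∈ range n, arc n b.1 b.2 x * q ^ x) * k b := by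
    simp only [load, sum_mul]
    rw [sum_comm, mul_sum]
    refine sum_congr rfl fun b _ => ?_
    rw [mul_assoc, sum_mul]
    congr 1
    exact sum_congr rfl fun x _ => by ring
  rw [h]
  refine Nat.ModEq.sum fun b hb => ?_
  rw [mem_product, mem_range, mem_range] at hb
  exact (modEq_sum_arc hq hb.2 (by omega)).mul_right _

/-- The exponent of the monomial selected by the multiplicities `k` in
`(∑ b, c b * y ^ ((q ^ b.1 - 1) * q ^ b.2)) ^ r`. -/
def expo (q : ℕ) (s : Finset (ℕ × ℕ)) (k : ℕ × ℕ → ℕ) : ℕ :=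
  ∑ b ∈ s, (q ^ b.1 - 1) * q ^ b.2 * k b

lemma sum_expo_modEq {n d e p q : ℕ} (hq : 1 ≤ q) (hdn : d ≤ n) (κ : ℕ → ℕ × ℕ → ℕ) :
    ∑ t ∈ range e, expo q (range (d + 1) ×ˢ range n) (κ t) * p ^ t ≡
      (q - 1) * ∑ x ∈ range n,
        (∑ t ∈ range e, load n (range (d + 1) ×ˢ range n) (κ t) x * p ^ t) * q ^ x
        [MOD q ^ n - 1] := by
  have h : (q - 1) * ∑ x ∈ range n,
        (∑ t ∈ range e, load n (range (d + 1) ×ˢ range n) (κ t) x * p ^ t) * q ^ x =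
      ∑ t ∈ range e,
        ((q - 1) * ∑ x ∈ range n, load n (range (d + 1) ×ˢ range n) (κ t) x * q ^ x) * p ^ t := by
    simp only [sum_mul]
    rw [sum_comm, mul_sum]
    refine sum_congr rfl fun t _ => ?_
    rw [mul_assoc, sum_mul]
    congr 1
    exact sum_congr rfl fun x _ => by ring
  rw [h]
  exact Nat.ModEq.sum fun t _ => (exponent_modEq hq hdn (κ t)).mul_right _

lemma modEq_of_pred_mul {q n a b : ℕ} (hq : 2 ≤ q)
    (h : (q - 1) * a ≡ (q - 1) * b [MOD q ^ n - 1]) : a ≡ b [MOD ∑ x ∈ range n, q ^ x] := by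
  rw [← geom_sum_mul_of_one_le (by omega : 1 ≤ q) n, mul_comm (∑ x ∈ range n, q ^ x)] at h
  exact h.mul_left_cancel' (by omega)

lemma load_twoArcs_values {n d p : ℕ} (hd : 1 ≤ d) (hn : 2 * d + 2 < n) (m : ℕ) :
    (m * arc n d 0 0 + (p - 1 - m) * arc n d 1 0 = m) ∧
    (m * arc n d 0 d + (p - 1 - m) * arc n d 1 d = p - 1 - m) ∧
    ∀ x, d < x → x < n → m * arc n d 0 x + (p - 1 - m) * arc n d 1 x = 0 := by
  have a00 : arc n d 0 0 = 1 := if_pos (by omega)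
  have a10 : arc n d 1 0 = 0 := if_neg (by omega)
  have a0d : arc n d 0 d = 0 := if_neg (by omega)
  have a1d : arc n d 1 d = 1 := if_pos (by omega)
  refine ⟨by simp [a00, a10], by simp [a0d, a1d], fun x h1 h2 => ?_⟩
  have a0 : arc n d 0 x = 0 := if_neg (by omega)
  have a1 : arc n d 1 x = 0 := if_neg (by omega)
  simp [a0, a1]

lemma arcs_le {n d p m : ℕ} (hm : m ≤ p - 1) (x : ℕ) :
    m * arc n d 0 x + (p - 1 - m) * arc n d 1 x ≤ p - 1 := by
  have h0 : arc n d 0 x ≤ 1 := by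
    unfold arc
    split_ifs <;> omega
  have h1 : arc n d 1 x ≤ 1 := by
    unfold arc
    split_ifs <;> omega
  have := Nat.mul_le_mul_left m h0
  have := Nat.mul_le_mul_left (p - 1 - m) h1
  omega

lemma eq_twoArcs_of_expo_modEq {n d e p m : ℕ} (hd : 1 ≤ d) (hn : 2 * d + 2 < n) (hp : 2 ≤ p)
    (he : 1 ≤ e) (hm : m = (p - 1) / 2) (hpar : p = 2 ∨ p = 2 * m + 1) {κ : ℕ → ℕ × ℕ → ℕ}
    (hκ : ∀ t < e, κ t ∈ (range (d + 1) ×ˢ range n).piAntidiag (p - 1))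
    (h : ∑ t ∈ range e, expo (p ^ e) (range (d + 1) ×ˢ range n) (κ t) * p ^ t ≡
      ∑ t ∈ range e, expo (p ^ e) (range (d + 1) ×ˢ range n) (twoArcs d m (p - 1 - m)) * p ^ t
        [MOD (p ^ e) ^ n - 1]) :
    ∀ t < e, κ t = twoArcs d m (p - 1 - m) := by
  have hq : 2 ≤ p ^ e := hp.trans (Nat.le_self_pow (by omega) p)
  have hmp : m + (p - 1 - m) = p - 1 := by omega
  obtain ⟨hg0, hgd, hg⟩ := load_twoArcs_values (p := p) hd hn m
  have h1 := modEq_of_pred_mul hq ((sum_expo_modEq (by omega) (by omega) κ).symm.trans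
    (h.trans (sum_expo_modEq (by omega) (by omega) fun _ => twoArcs d m (p - 1 - m))))
  simp only [load_twoArcs (show 1 < n by omega)] at h1
  have h2 := digits_eq_of_modEq (s := fun x t => load n (range (d + 1) ×ˢ range n) (κ t) x)
    hd hn hp he hm hpar hg0 hgd hg
    (fun x _ => arcs_le (by omega) x)
    (fun x _ t ht => load_le (hκ t ht))
    (fun t ht x y hxy _ hyx => load_add_load_le (hκ t ht) hxy hyx) h1
  intro t ht
  have hk := hκ t ht
  rw [← hmp] at hk
  exact eq_twoArcs_of_load_eq hd hn hk fun x hx => h2 x hx t ht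

lemma not_dvd_expo_twoArcs {n d e p m : ℕ} (hd : 1 ≤ d) (hn : 2 * d + 2 < n) (hp : 2 ≤ p)
    (he : 1 ≤ e) (hm : m = (p - 1) / 2) (hpar : p = 2 ∨ p = 2 * m + 1) :
    ¬ (p ^ e) ^ n - 1 ∣
      ∑ t ∈ range e, expo (p ^ e) (range (d + 1) ×ˢ range n) (twoArcs d m (p - 1 - m)) * p ^ t := by
  intro hdvd
  have hq : 2 ≤ p ^ e := hp.trans (Nat.le_self_pow (by omega) p)
  have hmp : m + (p - 1 - m) = p - 1 := by omega
  obtain ⟨hg0, hgd, hg⟩ := load_twoArcs_values (p := p) hd hn m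
  have h1 := modEq_of_pred_mul (a := 0) hq ((Nat.modEq_zero_iff_dvd.2 hdvd).symm.trans
    (sum_expo_modEq (by omega) (by omega) fun _ => twoArcs d m (p - 1 - m)))
  simp only [load_twoArcs (show 1 < n by omega)] at h1
  have h2 := digits_eq_of_modEq (s := fun _ _ => 0) hd hn hp he hm hpar hg0 hgd hg
    (fun x _ => arcs_le (by omega) x)
    (fun _ _ _ _ => Nat.zero_le _) (fun _ _ _ _ _ _ _ => Nat.zero_le _) (by simpa using h1)
    d (by omega) 0 he
  omega

lemma multinomial_cast_ne_zero {R : Type*} [Semiring R] {p : ℕ} [CharP R p] (hp : p.Prime)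
    {s : Finset (ℕ × ℕ)} {k : ℕ × ℕ → ℕ} (hk : k ∈ s.piAntidiag (p - 1)) :
    (Nat.multinomial s k : R) ≠ 0 := by
  rw [Ne, CharP.cast_eq_zero_iff R p]
  intro h
  have h1 := Nat.multinomial_spec s k
  rw [(mem_piAntidiag.1 hk).1] at h1
  have h2 := (hp.dvd_factorial).1 (h1 ▸ h.mul_left _)
  have := hp.pos
  omega

lemma exists_sum_eq_zero {L : Type*} [Field L] [Fintype L] {n d e p : ℕ} (hp : p.Prime)
    [CharP L p] (hd : 1 ≤ d) (hn : 2 * d + 2 < n) (he : 1 ≤ e)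
    (hL : Fintype.card L = (p ^ e) ^ n) {a : ℕ → L} (ha : a d ≠ 0)
    (hpow : ∀ y : L, y ≠ 0 →
      (∑ b ∈ range (d + 1) ×ˢ range n,
        (a b.1 * y ^ ((p ^ e) ^ b.1 - 1)) ^ (p ^ e) ^ b.2) ^ (p ^ e) =
      ∑ b ∈ range (d + 1) ×ˢ range n, (a b.1 * y ^ ((p ^ e) ^ b.1 - 1)) ^ (p ^ e) ^ b.2) :
    ∃ y : L, y ≠ 0 ∧ ∑ b ∈ range (d + 1) ×ˢ range n,
        (a b.1 * y ^ ((p ^ e) ^ b.1 - 1)) ^ (p ^ e) ^ b.2 = 0 := by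
  classical
  by_contra! hne
  have : Fact p.Prime := ⟨hp⟩
  obtain ⟨m, hm⟩ : ∃ m, m = (p - 1) / 2 := ⟨_, rfl⟩
  have hpar : p = 2 ∨ p = 2 * m + 1 := by
    rcases hp.eq_two_or_odd with h | h <;> omega
  have hmp : m + (p - 1 - m) = p - 1 := by omega
  set q := p ^ e with hq
  set s := range (d + 1) ×ˢ range n with hs
  set k₀ := twoArcs d m (p - 1 - m) with hk₀
  have hk₀mem : k₀ ∈ s.piAntidiag (p - 1) := hmp ▸ twoArcs_mem (by omega) m (p - 1 - m)
  let C : (ℕ × ℕ → ℕ) → L := fun k =>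
    (Nat.multinomial s k : L) * ∏ b ∈ s, (a b.1 ^ q ^ b.2) ^ k b
  let A : (Fin e → ℕ × ℕ → ℕ) → L := fun κ => ∏ t, C (κ t) ^ p ^ (t : ℕ)
  let E : (Fin e → ℕ × ℕ → ℕ) → ℕ := fun κ => ∑ t, expo q s (κ t) * p ^ (t : ℕ)
  have hexp : ∀ y : L, (∑ b ∈ s, (a b.1 * y ^ (q ^ b.1 - 1)) ^ q ^ b.2) ^ (q - 1) =
      ∑ κ ∈ Fintype.piFinset fun _ : Fin e => s.piAntidiag (p - 1), A κ * y ^ E κ := by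
    intro y
    have h1 : q - 1 = ∑ t : Fin e, (p - 1) * p ^ (t : ℕ) := by
      rw [Fin.sum_univ_eq_sum_range (fun t => (p - 1) * p ^ t), ← mul_sum, mul_comm,
        geom_sum_mul_of_one_le hp.one_lt.le]
    rw [h1, ← prod_pow_eq_pow_sum]
    have h2 : (∑ b ∈ s, (a b.1 * y ^ (q ^ b.1 - 1)) ^ q ^ b.2) ^ (p - 1) =
        ∑ k ∈ s.piAntidiag (p - 1), C k * y ^ expo q s k := by
      rw [sum_pow_eq_sum_piAntidiag]
      refine sum_congr rfl fun k _ => ?_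
      simp only [C, expo]
      rw [← prod_pow_eq_pow_sum, mul_assoc, ← prod_mul_distrib]
      congr 1
      refine prod_congr rfl fun b _ => ?_
      rw [mul_pow, mul_pow, ← pow_mul y, ← pow_mul y]
    simp_rw [pow_mul, h2, sum_pow_char_pow]
    rw [prod_univ_sum]
    refine sum_congr rfl fun κ _ => ?_
    simp only [A, E]
    rw [← prod_pow_eq_pow_sum, ← prod_mul_distrib]
    exact prod_congr rfl fun t _ => by rw [mul_pow, ← pow_mul]
  have hone : ∀ y : L, y ≠ 0 →
      ∑ κ ∈ Fintype.piFinset fun _ : Fin e => s.piAntidiag (p - 1), A κ * y ^ E κ = 1 := by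
    intro y hy
    rw [← hexp]
    refine mul_right_cancel₀ (hne y hy) ?_
    rw [← pow_succ, Nat.sub_add_cancel (Nat.one_le_pow _ _ hp.pos), hpow y hy, one_mul]
  set Q := q ^ n - 1 with hQ
  let κ₀ : Fin e → ℕ × ℕ → ℕ := fun _ => k₀
  have hE₀ : E κ₀ = ∑ t ∈ range e, expo q s k₀ * p ^ t :=
    Fin.sum_univ_eq_sum_range (fun t => expo q s k₀ * p ^ t) e
  have hQpos : 1 ≤ Q := by
    have : 2 ≤ q := hp.two_le.trans (Nat.le_self_pow (by omega) p)
    have := this.trans (Nat.le_self_pow (show n ≠ 0 by omega) q)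
    omega
  have hM : (Q - 1) * E κ₀ + E κ₀ = Q * E κ₀ := by
    rw [← Nat.succ_mul, Nat.succ_eq_add_one, Nat.sub_add_cancel hQpos]
  have hnd : ¬ Q ∣ E κ₀ := hE₀ ▸ not_dvd_expo_twoArcs hd hn hp.two_le he hm hpar
  have hndM : ¬ Q ∣ (Q - 1) * E κ₀ := fun h =>
    hnd ((Nat.dvd_add_right h).1 (hM ▸ dvd_mul_right _ _))
  have huniq : ∀ κ ∈ Fintype.piFinset fun _ : Fin e => s.piAntidiag (p - 1),
      Q ∣ (Q - 1) * E κ₀ + E κ → κ = κ₀ := by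
    intro κ hκ hdvd
    rw [Fintype.mem_piFinset] at hκ
    have h1 : E κ ≡ E κ₀ [MOD Q] := by
      refine Nat.ModEq.add_left_cancel' ((Q - 1) * E κ₀) ?_
      rw [hM]
      exact (Nat.modEq_zero_iff_dvd.2 hdvd).trans
        (Nat.modEq_zero_iff_dvd.2 (dvd_mul_right _ _)).symm
    let κ' : ℕ → ℕ × ℕ → ℕ := fun t => if h : t < e then κ ⟨t, h⟩ else 0
    have h2 : E κ = ∑ t ∈ range e, expo q s (κ' t) * p ^ t := by
      rw [← Fin.sum_univ_eq_sum_range (fun t => expo q s (κ' t) * p ^ t)]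
      simp [E, κ']
    rw [h2, hE₀] at h1
    have h3 := eq_twoArcs_of_expo_modEq hd hn hp.two_le he hm hpar
      (fun t ht => by simp only [κ', dif_pos ht]; exact hκ ⟨t, ht⟩) h1
    funext t
    simpa [κ'] using h3 t t.2
  have hA₀ : A κ₀ ≠ 0 := by
    refine prod_ne_zero_iff.2 fun t _ => pow_ne_zero _ (mul_ne_zero
      (multinomial_cast_ne_zero hp hk₀mem) (prod_ne_zero_iff.2 fun b _ => ?_))
    by_cases hb : b.1 = d
    · rw [hb]
      exact pow_ne_zero _ (pow_ne_zero _ ha)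
    · have : k₀ b = 0 := by
        have h0 : b ≠ (d, 0) := fun h => hb (by rw [h])
        have h1 : b ≠ (d, 1) := fun h => hb (by rw [h])
        simp [hk₀, twoArcs, h0, h1]
      simp [κ₀, this]
  have hsum : ∑ y : Lˣ, (y : L) ^ ((Q - 1) * E κ₀) *
      ∑ κ ∈ Fintype.piFinset fun _ : Fin e => s.piAntidiag (p - 1), A κ * (y : L) ^ E κ = 0 := by
    simp only [hone _ (Units.ne_zero _), mul_one]
    rw [FiniteField.sum_pow_units, hL, if_neg hndM]
  simp_rw [mul_sum] at hsum
  rw [sum_comm, sum_eq_single κ₀] at hsum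
  · simp only [mul_left_comm _ (A κ₀), ← pow_add, ← mul_sum] at hsum
    rw [FiniteField.sum_pow_units, hL, hM, if_pos (dvd_mul_right _ _)] at hsum
    simp [hA₀] at hsum
  · intro κ hκ hκ₀
    simp only [mul_left_comm _ (A κ), ← pow_add, ← mul_sum]
    rw [FiniteField.sum_pow_units, hL, if_neg fun h => hκ₀ (huniq κ hκ h), mul_zero]
  · exact fun h => absurd (Fintype.mem_piFinset.2 fun _ => hk₀mem) h

lemma algebraMap_trace_sum_pow {K L ι : Type*} [Field K] [Field L] [Algebra K L] [Fintype K]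
    [Finite L] (s : Finset ι) (f : ι → L) :
    algebraMap K L (Algebra.trace K L (∑ i ∈ s, f i)) =
      ∑ b ∈ s ×ˢ range (Module.finrank K L), f b.1 ^ Fintype.card K ^ b.2 := by
  rw [map_sum, map_sum, sum_product]
  exact sum_congr rfl fun i _ => by
    rw [FiniteField.algebraMap_trace_eq_sum_pow, Nat.card_eq_fintype_card]

end

/-- For F_{q^n}/F_q and an F_q-linearised polynomial f of q-degree d with
1 ≤ d < n/2 − 1, there exist nonzero x, y ∈ F_{q^n} with x·y = Tr(x)·f(y);
i.e. the club {(x : Tr(x))} and the linear set {(f(y) : y)} meet. -/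
theorem stmt_18 (q n d : ℕ) (hq : IsPrimePow q) (hd1 : 1 ≤ d) (hd : 2 * d + 2 < n)
    (K L : Type*) [Field K] [Field L] [Algebra K L] [Fintype K] [Fintype L]
    (hcard : Fintype.card K = q) (hrank : Module.finrank K L = n)
    (a : Fin (d + 1) → L) (ha : a (Fin.last d) ≠ 0) :
    ∃ x y : L, x ≠ 0 ∧ y ≠ 0 ∧
      x * y = algebraMap K L (Algebra.trace K L x) *
        (∑ i : Fin (d + 1), a i * y ^ q ^ (i : ℕ)) := by
  classical
  obtain ⟨p, hchar⟩ := CharP.exists K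
  obtain ⟨e, hp, hKe⟩ := FiniteField.card K p
  have : CharP L p := charP_of_injective_algebraMap (algebraMap K L).injective p
  have hqe : q = p ^ (e : ℕ) := hcard.symm.trans hKe
  have hL : Fintype.card L = (p ^ (e : ℕ)) ^ n := by
    rw [Module.card_eq_pow_finrank (K := K), hcard, hrank, hqe]
  obtain ⟨b, hb⟩ := Algebra.trace_surjective K L 1
  let c : ℕ → L := fun i => (if h : i < d + 1 then a ⟨i, h⟩ else 0) - if i = 0 then b else 0
  have hc : c d ≠ 0 := by
    have : c d = a (Fin.last d) := by
      simp [c, Nat.ne_of_gt hd1, Fin.last]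
    rwa [this]
  have htrace : ∀ y : L, algebraMap K L (Algebra.trace K L
      (∑ i ∈ Finset.range (d + 1), c i * y ^ (q ^ i - 1))) =
      ∑ b ∈ Finset.range (d + 1) ×ˢ Finset.range n, (c b.1 * y ^ (q ^ b.1 - 1)) ^ q ^ b.2 := by
    intro y
    rw [algebraMap_trace_sum_pow, hcard, hrank]
  subst hqe
  obtain ⟨y, hy, hsum⟩ := exists_sum_eq_zero hp hd1 hd e.pos hL hc fun y _ => by
    rw [← htrace, ← map_pow, ← hcard, FiniteField.pow_card]
  rw [← htrace, map_eq_zero] at hsum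
  have hterm : ∀ i, y ^ ((p ^ (e : ℕ)) ^ i - 1) = y ^ (p ^ (e : ℕ)) ^ i / y := by
    intro i
    rw [eq_div_iff hy, ← pow_succ, Nat.sub_add_cancel (Nat.one_le_pow _ _ (pow_pos hp.pos _))]
  have hdecomp : ∑ i ∈ Finset.range (d + 1), c i * y ^ ((p ^ (e : ℕ)) ^ i - 1) =
      (∑ i : Fin (d + 1), a i * y ^ (p ^ (e : ℕ)) ^ (i : ℕ)) / y - b := by
    simp only [c, sub_mul, Finset.sum_sub_distrib]
    congr 1
    · rw [← Fin.sum_univ_eq_sum_range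
        (fun i => (if h : i < d + 1 then a ⟨i, h⟩ else 0) * y ^ ((p ^ (e : ℕ)) ^ i - 1)),
        Finset.sum_div]
      exact Finset.sum_congr rfl fun i _ => by rw [dif_pos i.2, hterm, mul_div_assoc]
    · simp [ite_mul]
  rw [hdecomp, map_sub, hb, sub_eq_zero] at hsum
  refine ⟨(∑ i : Fin (d + 1), a i * y ^ (p ^ (e : ℕ)) ^ (i : ℕ)) / y, y, fun h => ?_, hy, ?_⟩
  · rw [h, map_zero] at hsum
    exact zero_ne_one hsum
  · rw [hsum, map_one, one_mul, div_mul_cancel₀ _ hy]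
end

section
/- Let q be a prime power, n ≥ 5 an integer, and a ∈ F_{q^n}. Then the function F : F_{q^n} → F_{q^n} defined by F(x) = Tr(x)² + a·x² is not planar; that is, there exists y ∈ F_{q^n} with y ≠ 0 such that the map x ↦ F(x + y) − F(x) − F(y) is not a bijection of F_{q^n}. -/
open Finset

theorem sum_eq_zero_add_sum_units {F M : Type*} [Field F] [Fintype F] [DecidableEq F]
    [AddCommMonoid M] (f : F → M) : ∑ a, f a = f 0 + ∑ u : Fˣ, f u := by
  rw [← add_sum_erase univ f (mem_univ 0)]
  congr 1
  refine (sum_bij (fun (u : Fˣ) _ => (u : F)) (by simp)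
    (fun _ _ _ _ h => Units.ext h) ?_ (by simp)).symm
  intro a ha
  exact ⟨Units.mk0 a (by simpa using ha), by simp⟩

theorem card_units_real (F : Type*) [Field F] [Fintype F] [DecidableEq F] :
    (Fintype.card Fˣ : ℝ) = Fintype.card F - 1 := by
  rw [Fintype.card_units, Nat.cast_sub Fintype.card_pos, Nat.cast_one]

/-- Orthogonality of additive characters counts the common zeros of two functions. -/
theorem sum_sum_addChar_eq_card {F ι : Type*} [Field F] [Fintype F] [DecidableEq F] [Fintype ι]
    {ψ : AddChar F ℂ} (hψ : ψ.IsPrimitive) (u v : ι → F) :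
    ∑ a, ∑ b, ∑ i, ψ (a * u i + b * v i) =
      (Fintype.card F : ℂ) ^ 2 * #{i | u i = 0 ∧ v i = 0} := by
  have key (i : ι) : ∑ a, ∑ b, ψ (a * u i + b * v i) =
      if u i = 0 ∧ v i = 0 then (Fintype.card F : ℂ) ^ 2 else 0 := by
    simp only [AddChar.map_add_eq_mul, ← mul_sum, ← sum_mul, AddChar.sum_mulShift _ hψ]
    by_cases hu : u i = 0 <;> by_cases hv : v i = 0 <;> simp [hu, hv, sq]
  rw [sum_congr rfl fun a _ => sum_comm, sum_comm, sum_congr rfl fun i _ => key i, ← sum_filter,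
    sum_const, nsmul_eq_mul, mul_comm]

theorem sum_sum_norm_sq_eq_card {F ι : Type*} [Field F] [Fintype F] [DecidableEq F] [Fintype ι]
    {ψ : AddChar F ℂ} (hψ : ψ.IsPrimitive) (u v : ι → F) :
    ∑ a, ∑ b, ‖∑ i, ψ (a * u i + b * v i)‖ ^ 2 =
      (Fintype.card F : ℝ) ^ 2 * #{p : ι × ι | u p.1 = u p.2 ∧ v p.1 = v p.2} := by
  have h := sum_sum_addChar_eq_card hψ (fun p : ι × ι => u p.1 - u p.2)
    (fun p : ι × ι => v p.1 - v p.2)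
  simp only [sub_eq_zero] at h
  apply Complex.ofReal_injective
  push_cast
  rw [← h]
  refine sum_congr rfl fun a _ => sum_congr rfl fun b _ => ?_
  rw [← Complex.mul_conj', map_sum, sum_mul_sum, Fintype.sum_prod_type]
  refine sum_congr rfl fun i _ => sum_congr rfl fun j _ => ?_
  rw [← AddChar.map_neg_eq_conj, ← AddChar.map_add_eq_mul]
  congr 1
  ring

/-- The Kloosterman sum attached to an additive character of a finite field. -/
noncomputable def kloosterman {F : Type*} [Field F] [Fintype F] [DecidableEq F]
    (ψ : AddChar F ℂ) (a b : F) : ℂ :=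
  ∑ x : Fˣ, ψ (a * x + b * (x⁻¹ : Fˣ))

section Kloosterman

variable {F : Type*} [Field F] [Fintype F] [DecidableEq F] {ψ : AddChar F ℂ}

theorem kloosterman_units_mul (ψ : AddChar F ℂ) (c : Fˣ) (a b : F) :
    kloosterman ψ (c * a) b = kloosterman ψ a (c * b) := by
  unfold kloosterman
  refine Fintype.sum_equiv (Equiv.mulLeft c) _ _ fun x => ?_
  congr 1
  simp only [Equiv.coe_mulLeft, mul_inv_rev, Units.val_mul]
  have : (c : F) * (c⁻¹ : Fˣ) = 1 := by simp
  linear_combination (-b * (x⁻¹ : Fˣ)) * this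

theorem kloosterman_comm (ψ : AddChar F ℂ) (a b : F) :
    kloosterman ψ a b = kloosterman ψ b a := by
  unfold kloosterman
  refine Fintype.sum_equiv (Equiv.inv _) _ _ fun x => ?_
  simp [add_comm]

theorem kloosterman_zero_zero (ψ : AddChar F ℂ) :
    kloosterman ψ 0 0 = (Fintype.card F : ℂ) - 1 := by
  simp [kloosterman, Fintype.card_units, Nat.cast_sub Fintype.card_pos]

theorem kloosterman_zero_right (hψ : ψ.IsPrimitive) {a : F} (ha : a ≠ 0) :
    kloosterman ψ a 0 = -1 := by
  have h := AddChar.sum_mulShift a hψ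
  rw [sum_eq_zero_add_sum_units] at h
  simp only [zero_mul, AddChar.map_zero_eq_one, ha, if_false, Nat.cast_zero] at h
  simp only [kloosterman, zero_mul, add_zero, mul_comm a]
  linear_combination h

theorem kloosterman_zero_left (hψ : ψ.IsPrimitive) {a : F} (ha : a ≠ 0) :
    kloosterman ψ 0 a = -1 := by
  rw [kloosterman_comm, kloosterman_zero_right hψ ha]

theorem sum_sum_kloosterman (hψ : ψ.IsPrimitive) (g : ℂ → ℝ) :
    ∑ a, ∑ b, g (kloosterman ψ a b) = g ((Fintype.card F : ℂ) - 1) +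
      (Fintype.card F - 1 : ℝ) * (2 * g (-1) + ∑ c : Fˣ, g (kloosterman ψ 1 c)) := by
  have h1 (a : Fˣ) : ∑ b : Fˣ, g (kloosterman ψ a b) = ∑ c : Fˣ, g (kloosterman ψ 1 c) := by
    refine Fintype.sum_equiv (Equiv.mulLeft a) _ _ fun b => ?_
    rw [Equiv.coe_mulLeft, Units.val_mul, ← kloosterman_units_mul, mul_one]
  rw [sum_eq_zero_add_sum_units]
  simp only [sum_eq_zero_add_sum_units (fun b => g (kloosterman ψ _ b)), h1,
    kloosterman_zero_zero, kloosterman_zero_right hψ (Units.ne_zero _),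
    kloosterman_zero_left hψ (Units.ne_zero _), sum_const, card_univ, nsmul_eq_mul,
    card_units_real]
  ring

theorem card_sub_one_pos (F : Type*) [Field F] [Fintype F] : (0 : ℝ) < Fintype.card F - 1 := by
  have : (1 : ℝ) < Fintype.card F := by exact_mod_cast Fintype.one_lt_card
  linarith

theorem sum_norm_kloosterman_sq (hψ : ψ.IsPrimitive) :
    ∑ c : Fˣ, ‖kloosterman ψ 1 c‖ ^ 2 = (Fintype.card F : ℝ) ^ 2 - Fintype.card F - 1 := by
  have h := sum_sum_norm_sq_eq_card hψ (fun x : Fˣ => (x : F)) (fun x => ((x⁻¹ : Fˣ) : F))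
  have hc : #{p : Fˣ × Fˣ | (p.1 : F) = p.2 ∧ ((p.1⁻¹ : Fˣ) : F) = (p.2⁻¹ : Fˣ)} =
      Fintype.card Fˣ := by
    rw [← card_univ, ← card_image_of_injective univ (f := fun x : Fˣ => (x, x))
      fun _ _ h => congrArg Prod.fst h]
    apply congrArg
    ext ⟨x, y⟩
    simp +contextual [Units.val_inj]
  have h2 := sum_sum_kloosterman hψ (fun z => ‖z‖ ^ 2)
  have hn : ‖(Fintype.card F : ℂ) - 1‖ = Fintype.card F - 1 := by
    have := card_sub_one_pos F
    rw [← Complex.ofReal_natCast, ← Complex.ofReal_one, ← Complex.ofReal_sub, Complex.norm_real,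
      Real.norm_of_nonneg this.le]
  rw [hc, card_units_real] at h
  unfold kloosterman at h2 ⊢
  rw [h, hn] at h2
  apply mul_left_cancel₀ (card_sub_one_pos F).ne'
  simp only [norm_neg, norm_one] at h2
  linear_combination -h2

theorem card_add_eq_add_inv_le :
    #{p : (Fˣ × Fˣ) × (Fˣ × Fˣ) | (p.1.1 : F) + p.1.2 = p.2.1 + p.2.2 ∧
      ((p.1.1⁻¹ : Fˣ) : F) + (p.1.2⁻¹ : Fˣ) = (p.2.1⁻¹ : Fˣ) + (p.2.2⁻¹ : Fˣ)} ≤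
      3 * Fintype.card Fˣ ^ 2 := by
  have hsub : ({p : (Fˣ × Fˣ) × (Fˣ × Fˣ) | (p.1.1 : F) + p.1.2 = p.2.1 + p.2.2 ∧
      ((p.1.1⁻¹ : Fˣ) : F) + (p.1.2⁻¹ : Fˣ) = (p.2.1⁻¹ : Fˣ) + (p.2.2⁻¹ : Fˣ)} : Finset _) ⊆
      univ.image (fun x : Fˣ × Fˣ => ((x.1, -x.1), (x.2, -x.2))) ∪
      (univ.image (fun x : Fˣ × Fˣ => ((x.1, x.2), (x.1, x.2))) ∪
      univ.image (fun x : Fˣ × Fˣ => ((x.1, x.2), (x.2, x.1)))) := by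
    rintro ⟨⟨x, y⟩, ⟨z, w⟩⟩ hp
    simp only [mem_filter, mem_univ, true_and, Units.val_inv_eq_inv_val] at hp
    obtain ⟨h1, h2⟩ := hp
    simp only [mem_union, mem_image, mem_univ, true_and, Prod.exists, Prod.mk.injEq]
    have hx := x.ne_zero
    have hy := y.ne_zero
    have hz := z.ne_zero
    have hw := w.ne_zero
    field_simp at h2
    have h3 : ((x : F) + y) * ((z - x) * (z - y)) = 0 := by
      linear_combination -h2 + (x * y - z * (x + y)) * h1
    rcases mul_eq_zero.1 h3 with h | h
    · left
      have h' : (z : F) + w = 0 := h1 ▸ h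
      exact ⟨x, z, ⟨rfl, Units.ext (by simp; linear_combination -h)⟩, rfl,
        Units.ext (by simp; linear_combination -h')⟩
    · right
      rcases mul_eq_zero.1 h with h | h
      · left
        exact ⟨x, y, ⟨rfl, rfl⟩, Units.ext (by linear_combination -h),
          Units.ext (by linear_combination h1 + h)⟩
      · right
        exact ⟨x, y, ⟨rfl, rfl⟩, Units.ext (by linear_combination -h),
          Units.ext (by linear_combination h1 + h)⟩
  have hcard : #(univ : Finset (Fˣ × Fˣ)) = Fintype.card Fˣ ^ 2 := by
    rw [card_univ, Fintype.card_prod, sq]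
  refine (card_le_card hsub).trans ((card_union_le _ _).trans ?_)
  grw [card_union_le, card_image_le, card_image_le, card_image_le, hcard]
  omega

theorem sum_norm_kloosterman_pow_four_le (hψ : ψ.IsPrimitive) :
    ∑ c : Fˣ, ‖kloosterman ψ 1 c‖ ^ 4 ≤
      2 * (Fintype.card F : ℝ) ^ 3 - 3 * Fintype.card F - 1 := by
  have h := sum_sum_norm_sq_eq_card hψ (fun x : Fˣ × Fˣ => (x.1 : F) + x.2)
    (fun x => ((x.1⁻¹ : Fˣ) : F) + (x.2⁻¹ : Fˣ))
  have hk (a b : F) : ∑ x : Fˣ × Fˣ, ψ (a * ((x.1 : F) + x.2) +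
      b * (((x.1⁻¹ : Fˣ) : F) + (x.2⁻¹ : Fˣ))) = kloosterman ψ a b ^ 2 := by
    rw [kloosterman, sq, sum_mul_sum, Fintype.sum_prod_type]
    refine sum_congr rfl fun i _ => sum_congr rfl fun j _ => ?_
    rw [← AddChar.map_add_eq_mul]
    congr 1
    ring
  have hc : (_ : ℝ) ≤ _ := Nat.cast_le.2 (card_add_eq_add_inv_le (F := F))
  have h2 := sum_sum_kloosterman hψ (fun z => ‖z ^ 2‖ ^ 2)
  have hn : ‖(Fintype.card F : ℂ) - 1‖ = Fintype.card F - 1 := by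
    have := card_sub_one_pos F
    rw [← Complex.ofReal_natCast, ← Complex.ofReal_one, ← Complex.ofReal_sub, Complex.norm_real,
      Real.norm_of_nonneg this.le]
  simp only [hk] at h
  push_cast at hc
  rw [card_units_real] at hc
  rw [h] at h2
  simp only [norm_pow, hn, norm_neg, norm_one, ← pow_mul] at h2
  norm_num at h2
  refine le_of_mul_le_mul_left ?_ (card_sub_one_pos F)
  have := mul_le_mul_of_nonneg_left hc (sq_nonneg (Fintype.card F : ℝ))
  linarith

theorem sum_norm_kloosterman_sq_sub_card_sq_le (hψ : ψ.IsPrimitive) :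
    ∑ c : Fˣ, (‖kloosterman ψ 1 c‖ ^ 2 - Fintype.card F) ^ 2 ≤
      (Fintype.card F : ℝ) ^ 2 * (Fintype.card F + 1) := by
  have h2 := sum_norm_kloosterman_sq hψ
  have h4 := sum_norm_kloosterman_pow_four_le hψ
  have hc := card_units_real F
  have hp := card_sub_one_pos F
  simp only [sub_sq, sum_add_distrib, sum_sub_distrib, ← pow_mul, sum_const, card_univ,
    nsmul_eq_mul, ← sum_mul, ← mul_sum, hc, h2]
  norm_num
  linarith

end Kloosterman

/-- The additive character of `L` obtained from one of `K` by composing with the trace. -/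
noncomputable def traceAddChar {K : Type*} (L : Type*) [Field K] [Field L] [Algebra K L] (ψ : AddChar K ℂ) :
    AddChar L ℂ :=
  ψ.compAddMonoidHom (Algebra.trace K L).toAddMonoidHom

theorem traceAddChar_apply {K L : Type*} [Field K] [Field L] [Algebra K L] (ψ : AddChar K ℂ) (x : L) :
    traceAddChar L ψ x = ψ (Algebra.trace K L x) := rfl

section Trace

variable {K L : Type*} [Field K] [Field L] [Algebra K L] [Fintype K] [Fintype L]

theorem traceAddChar_isPrimitive {ψ : AddChar K ℂ} (hψ : ψ.IsPrimitive) :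
    (traceAddChar L ψ).IsPrimitive := by
  apply AddChar.IsPrimitive.of_ne_one
  intro h
  apply hψ (one_ne_zero)
  ext c
  obtain ⟨x, rfl⟩ := Algebra.trace_surjective K L c
  simpa [traceAddChar_apply, AddChar.mulShift_apply] using DFunLike.congr_fun h x

theorem sum_units_kloosterman_of_forall_trace [DecidableEq K] [DecidableEq L] {ψ : AddChar K ℂ} (hψ : ψ.IsPrimitive) (b : Lˣ)
    (h : ∀ x : Lˣ, Algebra.trace K L x = 1 → Algebra.trace K L (b * (x⁻¹ : Lˣ)) ≠ -1) :
    ∑ c : Kˣ, kloosterman ψ (-1) c * kloosterman (traceAddChar L ψ) 1 (algebraMap K L c * b) =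
      -((Fintype.card L : ℂ) + 1) := by
  have hΨ := traceAddChar_isPrimitive (L := L) hψ
  have h0 := sum_sum_addChar_eq_card hψ (fun x : Lˣ => Algebra.trace K L x - 1)
    (fun x : Lˣ => Algebra.trace K L (b * (x⁻¹ : Lˣ)) + 1)
  have he : #{x : Lˣ | Algebra.trace K L x - 1 = 0 ∧
      Algebra.trace K L (b * (x⁻¹ : Lˣ)) + 1 = 0} = 0 := by
    rw [card_eq_zero, filter_eq_empty_iff]
    rintro x - ⟨h1, h2⟩
    exact h x (sub_eq_zero.1 h1) (eq_neg_of_add_eq_zero_left h2)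
  rw [he, Nat.cast_zero, mul_zero] at h0
  have hk (α β : K) : ∑ x : Lˣ, ψ (α * (Algebra.trace K L x - 1) +
      β * (Algebra.trace K L (b * (x⁻¹ : Lˣ)) + 1)) =
      ψ (β - α) * kloosterman (traceAddChar L ψ) (algebraMap K L α) (algebraMap K L β * b) := by
    rw [kloosterman, mul_sum]
    refine sum_congr rfl fun x _ => ?_
    rw [traceAddChar_apply, ← AddChar.map_add_eq_mul, mul_assoc, ← Algebra.smul_def,
      ← Algebra.smul_def, map_add (Algebra.trace K L), map_smul, map_smul, smul_eq_mul, smul_eq_mul]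
    congr 1
    ring
  have hne (c : Kˣ) : algebraMap K L c ≠ 0 := by simp
  have hα (α : Kˣ) : ∑ β : Kˣ, ψ (β - α) *
      kloosterman (traceAddChar L ψ) (algebraMap K L α) (algebraMap K L β * b) =
      ∑ c : Kˣ, ψ (-1 * α + c * (α⁻¹ : Kˣ)) *
        kloosterman (traceAddChar L ψ) 1 (algebraMap K L c * b) := by
    refine Fintype.sum_equiv (Equiv.mulLeft α) _ _ fun β => ?_
    have := kloosterman_units_mul (traceAddChar L ψ) (Units.mk0 _ (hne α)) 1
      (algebraMap K L β * b)
    rw [mul_one, Units.val_mk0] at this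
    rw [this]
    simp only [Equiv.coe_mulLeft, Units.val_mul, map_mul, mul_assoc]
    congr 2
    have : (α : K) * (α⁻¹ : Kˣ) = 1 := by simp
    linear_combination (-β : K) * this
  have hs (s : K) (hs : s ≠ 0) : ∑ c : Kˣ, ψ (s * c) = -1 := by
    simpa [kloosterman] using kloosterman_zero_right hψ hs
  simp only [hk] at h0
  rw [sum_eq_zero_add_sum_units] at h0
  simp only [sum_eq_zero_add_sum_units (fun β => ψ (β - _) * _), hα] at h0
  rw [sum_add_distrib, sum_comm] at h0
  simp only [← sum_mul] at h0
  change _ + (_ + ∑ c : Kˣ, kloosterman ψ (-1) c * _) = 0 at h0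
  simp only [map_zero, zero_mul, kloosterman_zero_zero, sub_zero, zero_sub,
    kloosterman_zero_left hΨ (mul_ne_zero (hne _) b.ne_zero), kloosterman_zero_right hΨ (hne _),
    AddChar.map_zero_eq_one, ← sum_mul] at h0
  have h1 := hs 1 one_ne_zero
  have h2 := hs (-1) (neg_ne_zero.2 one_ne_zero)
  simp only [one_mul, neg_one_mul] at h1 h2
  rw [h1, h2] at h0
  linear_combination h0

theorem sum_norm_kloosterman_sq_algebraMap_mul_le [DecidableEq K] [DecidableEq L] {Ψ : AddChar L ℂ}
    (hΨ : Ψ.IsPrimitive) (b : Lˣ)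
    (hcard : (Fintype.card K : ℝ) ^ 4 * (Fintype.card K : ℝ) ≤ Fintype.card L) :
    ∑ c : Kˣ, ‖kloosterman Ψ 1 (algebraMap K L c * b)‖ ^ 2 ≤
      (Fintype.card K - 1) * Fintype.card L +
        (Fintype.card L : ℝ) * (Fintype.card L / (Fintype.card K : ℝ) ^ 2) := by
  set q := (Fintype.card K : ℝ) with hq
  set Q := (Fintype.card L : ℝ)
  have hq1 : 0 < q - 1 := card_sub_one_pos K
  have hinj : Function.Injective fun c : Kˣ => Units.map (algebraMap K L).toMonoidHom c * b := by
    intro c d hcd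
    exact Units.map_injective (algebraMap K L).injective (mul_right_cancel hcd)
  have hV : ∑ c : Kˣ, (‖kloosterman Ψ 1 (algebraMap K L c * b)‖ ^ 2 - Q) ^ 2 ≤
      Q ^ 2 * (Q + 1) := by
    refine le_trans ?_ (sum_norm_kloosterman_sq_sub_card_sq_le hΨ)
    exact (sum_image (s := univ) (f := fun d : Lˣ => (‖kloosterman Ψ 1 d‖ ^ 2 - Q) ^ 2)
      hinj.injOn).symm.trans_le (sum_le_sum_of_subset_of_nonneg (subset_univ _)
        fun _ _ _ => sq_nonneg _)
  have hCS := sum_mul_sq_le_sq_mul_sq univ (fun _ : Kˣ => (1 : ℝ))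
    fun c => ‖kloosterman Ψ 1 (algebraMap K L c * b)‖ ^ 2 - Q
  simp only [one_mul, one_pow, sum_const, card_univ, nsmul_eq_mul, mul_one,
    card_units_real, sum_sub_distrib, ← hq] at hCS
  rw [← sub_le_iff_le_add']
  have hQ0 : 0 ≤ Q := Nat.cast_nonneg _
  have hqQ : q ≤ Q := le_trans (le_mul_of_one_le_left (by linarith) (one_le_pow₀ (by linarith)))
    hcard
  refine abs_le_of_sq_le_sq' ?_ (by positivity) |>.2
  calc _ ≤ (q - 1) * (Q ^ 2 * (Q + 1)) := hCS.trans (by gcongr)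
    _ ≤ Q ^ 2 * (q * Q) := by nlinarith [mul_nonneg (sq_nonneg Q) (sub_nonneg.2 hqQ)]
    _ ≤ Q ^ 2 * (Q ^ 2 / q ^ 4) := by
      gcongr
      rw [le_div_iff₀ (by positivity)]
      nlinarith
    _ = _ := by ring

theorem exists_trace_eq_one_and_trace_mul_inv_eq_neg_one (hn : 5 ≤ Module.finrank K L) (b : Lˣ) :
    ∃ x : Lˣ, Algebra.trace K L x = 1 ∧ Algebra.trace K L (b * (x⁻¹ : Lˣ)) = -1 := by
  classical
  by_contra! h
  have hψ := AddChar.FiniteField.primitiveChar_to_Complex_isPrimitive K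
  set ψ := AddChar.FiniteField.primitiveChar_to_Complex K
  have hq1 := card_sub_one_pos K
  have hcard : (Fintype.card K : ℝ) ^ 4 * Fintype.card K ≤ Fintype.card L := by
    rw [Module.card_eq_pow_finrank (K := K) (V := L), ← pow_succ, Nat.cast_pow]
    exact pow_le_pow_right₀ (by linarith) hn
  have hA := sum_norm_kloosterman_sq_algebraMap_mul_le (traceAddChar_isPrimitive hψ) b hcard
  have hB := sum_norm_kloosterman_sq hψ
  have hB' : ∑ c : Kˣ, ‖kloosterman ψ (-1) c‖ ^ 2 =
      (Fintype.card K : ℝ) ^ 2 - Fintype.card K - 1 := by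
    rw [← hB]
    refine Fintype.sum_equiv (Equiv.neg _) _ _ fun c => ?_
    have := kloosterman_units_mul ψ (-1) 1 c
    rw [mul_one, Units.val_neg, Units.val_one, neg_one_mul] at this
    rw [this, Equiv.neg_apply, Units.val_neg]
  have hsum := congrArg norm (sum_units_kloosterman_of_forall_trace hψ b h)
  have hn : ‖-((Fintype.card L : ℂ) + 1)‖ = Fintype.card L + 1 := by
    rw [norm_neg]
    exact_mod_cast Complex.norm_natCast (Fintype.card L + 1)
  rw [hn] at hsum
  have hle := norm_sum_le (univ : Finset Kˣ) fun c => kloosterman ψ (-1) c *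
    kloosterman (traceAddChar L ψ) 1 (algebraMap K L c * b)
  rw [hsum] at hle
  simp only [norm_mul] at hle
  have hCS := sum_mul_sq_le_sq_mul_sq univ (fun c : Kˣ => ‖kloosterman ψ (-1) c‖)
    fun c => ‖kloosterman (traceAddChar L ψ) 1 (algebraMap K L c * b)‖
  rw [hB'] at hCS
  have hB0 : 0 ≤ (Fintype.card K : ℝ) ^ 2 - Fintype.card K - 1 :=
    hB' ▸ sum_nonneg fun _ _ => sq_nonneg _
  generalize (Fintype.card K : ℝ) = q at *
  have hQ0 : (0 : ℝ) ≤ Fintype.card L := Nat.cast_nonneg _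
  generalize (Fintype.card L : ℝ) = Q at *
  have hq0 : 0 < q := by linarith
  have hlt : (Q + 1) ^ 2 ≤ (q ^ 2 - q - 1) * ((q - 1) * Q + Q * (Q / q ^ 2)) :=
    (pow_le_pow_left₀ (by positivity) hle 2).trans
      (hCS.trans (mul_le_mul_of_nonneg_left hA hB0))
  have hR : (q ^ 2 - q - 1) * ((q - 1) + Q / q ^ 2) ≤ Q := by
    have hY : q ^ 3 ≤ Q / q ^ 2 := by
      rw [le_div_iff₀ (by positivity)]
      linarith
    have hQY : Q = q ^ 2 * (Q / q ^ 2) := by field_simp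
    generalize Q / q ^ 2 = Y at *
    have h3 : (q ^ 2 - q - 1) * (q - 1) ≤ q ^ 3 := by nlinarith
    have hY0 : 0 ≤ Y := le_trans (by positivity) hY
    have := mul_nonneg hq0.le hY0
    rw [hQY]
    linarith
  have := mul_le_mul_of_nonneg_left hR hQ0
  linarith

end Trace


/-- For F_{q^n}/F_q with n ≥ 5 and any a ∈ F_{q^n}, the function
F(x) = Tr(x)² + a·x² is not planar: some nonzero y gives a non-bijective
difference map x ↦ F(x+y) − F(x) − F(y). -/
theorem stmt_19 (q n : ℕ) (hq : IsPrimePow q) (hn : 5 ≤ n)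
    (K L : Type*) [Field K] [Field L] [Algebra K L] [Fintype K] [Fintype L]
    (hcard : Fintype.card K = q) (hrank : Module.finrank K L = n)
    (a : L) :
    ∃ y : L, y ≠ 0 ∧ ¬ Function.Bijective (fun x : L =>
      (algebraMap K L (Algebra.trace K L (x + y)) ^ 2 + a * (x + y) ^ 2)
      - (algebraMap K L (Algebra.trace K L x) ^ 2 + a * x ^ 2)
      - (algebraMap K L (Algebra.trace K L y) ^ 2 + a * y ^ 2)) := by
  obtain ⟨x, y, hx, hy, h⟩ : ∃ x y : L, x ≠ 0 ∧ y ≠ 0 ∧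
      algebraMap K L (Algebra.trace K L x) * algebraMap K L (Algebra.trace K L y) +
        a * (x * y) = 0 := by
    by_cases ha : a = 0
    · have hker : (Algebra.trace K L).ker ≠ ⊥ := by
        apply LinearMap.ker_ne_bot_of_finrank_lt
        rw [Module.finrank_self]
        omega
      obtain ⟨x, hx, hx0⟩ := Submodule.exists_mem_ne_zero_of_ne_bot hker
      exact ⟨x, x, hx0, hx0, by simp [LinearMap.mem_ker.1 hx, ha]⟩
    · obtain ⟨x, hx, hy⟩ := exists_trace_eq_one_and_trace_mul_inv_eq_neg_one
        (hn.trans_eq hrank.symm) (Units.mk0 a ha)⁻¹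
      refine ⟨x, ((Units.mk0 a ha)⁻¹ : Lˣ) * (x⁻¹ : Lˣ), x.ne_zero,
        mul_ne_zero (Units.ne_zero _) (Units.ne_zero _), ?_⟩
      rw [hx, hy]
      have hx0 := x.ne_zero
      simp
      field_simp
      simp
  refine ⟨y, hy, fun hF => hx (hF.injective ?_)⟩
  simp only [map_add, zero_add, map_zero]
  linear_combination 2 * h
end
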